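/- Let ω be a weight function, φ(x) = ω(e^x), φ* its Young conjugate, h > 0, and v : ℝ^d → (0,∞) continuous. Then 𝒮^{ω,h}_v, the set of φ ∈ C^∞(ℝ^d) with ‖φ‖ := sup_{α∈ℕ^d} sup_{x∈ℝ^d} |φ^{(α)}(x)| v(x) exp(−(1/h)φ*(h|α|)) < ∞, is a Banach space with this norm. -/

import Mathlib

open Real Set

/-- The Young (Legendre) conjugate of `φ` on the half-line `[0, ∞)`. -/
noncomputable def youngConj (φ : ℝ → ℝ) (y : ℝ) : ℝ :=
  sSup ((fun x => x * y - φ x) '' Set.Ici 0)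

/-- Completeness of the Banach space `𝒮^{ω,h}_v`: every Cauchy sequence for the weighted
Gelfand–Shilov norm converges, in that norm, to a smooth function of finite norm. -/
theorem stmt18 (d : ℕ) (ω : ℝ → ℝ)
    (hmono : MonotoneOn ω (Set.Ici 0))
    (hcont : ContinuousOn ω (Set.Ici 0))
    (hnonneg : ∀ t ≥ (0:ℝ), 0 ≤ ω t)
    (hω0 : ω 0 = 0)
    (hα : ∃ C > (0:ℝ), ∀ t ≥ (0:ℝ), ω (2 * t) ≤ C * (ω t + 1))
    (hγ : Asymptotics.IsLittleO Filter.atTop Real.log ω)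
    (hδ : ConvexOn ℝ (Set.Ici 0) (fun x => ω (Real.exp x)))
    (h : ℝ) (hh : 0 < h)
    (v : EuclideanSpace ℝ (Fin d) → ℝ) (hvc : Continuous v) (hv : ∀ x, 0 < v x)
    (F : ℕ → EuclideanSpace ℝ (Fin d) → ℂ)
    (hFsm : ∀ j, ContDiff ℝ (⊤ : ℕ∞) (F j))
    (hFb : ∀ j, ∃ M : ℝ, ∀ (n : ℕ) (x : EuclideanSpace ℝ (Fin d)),
      ‖iteratedFDeriv ℝ n (F j) x‖ * v x *
        Real.exp (-(1 / h) * youngConj (fun u => ω (Real.exp u)) (h * n)) ≤ M)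
    (hcauchy : ∀ ε > (0:ℝ), ∃ N : ℕ, ∀ i ≥ N, ∀ j ≥ N,
      ∀ (n : ℕ) (x : EuclideanSpace ℝ (Fin d)),
        ‖iteratedFDeriv ℝ n (F i) x - iteratedFDeriv ℝ n (F j) x‖ * v x *
          Real.exp (-(1 / h) * youngConj (fun u => ω (Real.exp u)) (h * n)) ≤ ε) :
    ∃ φ : EuclideanSpace ℝ (Fin d) → ℂ, ContDiff ℝ (⊤ : ℕ∞) φ ∧
      (∃ M : ℝ, ∀ (n : ℕ) (x : EuclideanSpace ℝ (Fin d)),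
        ‖iteratedFDeriv ℝ n φ x‖ * v x *
          Real.exp (-(1 / h) * youngConj (fun u => ω (Real.exp u)) (h * n)) ≤ M) ∧
      ∀ ε > (0:ℝ), ∃ N : ℕ, ∀ j ≥ N, ∀ (n : ℕ) (x : EuclideanSpace ℝ (Fin d)),
        ‖iteratedFDeriv ℝ n (F j) x - iteratedFDeriv ℝ n φ x‖ * v x *
          Real.exp (-(1 / h) * youngConj (fun u => ω (Real.exp u)) (h * n)) ≤ ε := by
  
  set c : ℕ → ℝ := fun n =>
    Real.exp (-(1 / h) * youngConj (fun u => ω (Real.exp u)) (h * n)) with hc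
  have hcpos : ∀ n, 0 < c n := fun n => Real.exp_pos _
  have hcs : ∀ (n : ℕ) x, CauchySeq (fun j => iteratedFDeriv ℝ n (F j) x) := by
    intro n x
    rw [Metric.cauchySeq_iff]
    intro ε hε
    have hp : 0 < v x * c n := mul_pos (hv x) (hcpos n)
    obtain ⟨N, hN⟩ := hcauchy (ε / 2 * (v x * c n)) (by positivity)
    refine ⟨N, fun i hi j hj => ?_⟩
    have h1 := hN i hi j hj n x
    rw [mul_assoc] at h1
    have h2 := le_of_mul_le_mul_right h1 hp
    rw [dist_eq_norm]
    linarith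
  choose p hp using fun (x : EuclideanSpace ℝ (Fin d)) (n : ℕ) =>
    cauchySeq_tendsto_of_complete (hcs n x)
  have hlim : ∀ ε > (0:ℝ), ∃ N : ℕ, ∀ j ≥ N, ∀ (n : ℕ) (x : EuclideanSpace ℝ (Fin d)),
      ‖iteratedFDeriv ℝ n (F j) x - p x n‖ * v x * c n ≤ ε := by
    intro ε hε
    obtain ⟨N, hN⟩ := hcauchy ε hε
    refine ⟨N, fun j hj n x => ?_⟩
    have ht : Filter.Tendsto
        (fun i => ‖iteratedFDeriv ℝ n (F j) x - iteratedFDeriv ℝ n (F i) x‖ * v x * c n)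
        Filter.atTop (nhds (‖iteratedFDeriv ℝ n (F j) x - p x n‖ * v x * c n)) :=
      (((tendsto_const_nhds.sub (hp x n)).norm).mul_const _).mul_const _
    refine le_of_tendsto ht ?_
    filter_upwards [Filter.eventually_ge_atTop N] with i hi
    exact hN j hj i hi n x
  have hunif : ∀ n : ℕ, TendstoLocallyUniformlyOn
      (fun j x => (iteratedFDeriv ℝ (n+1) (F j) x).curryLeft)
      (fun x => (p x (n+1)).curryLeft) Filter.atTop Set.univ := by
    intro n
    refine (Metric.tendstoLocallyUniformlyOn_iff (β := EuclideanSpace ℝ (Fin d))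
      (α := EuclideanSpace ℝ (Fin d) →L[ℝ] (EuclideanSpace ℝ (Fin d) [×n]→L[ℝ] ℂ))).2 ?_
    intro ε hε x _
    have hvx := hv x
    have hcn := hcpos (n+1)
    refine ⟨{y | v x / 2 < v y}, ?_, ?_⟩
    · rw [nhdsWithin_univ]
      exact (isOpen_lt continuous_const hvc).mem_nhds (by change v x / 2 < v x; linarith)
    · obtain ⟨N, hN⟩ := hlim (ε / 2 * (v x / 2 * c (n+1))) (by positivity)
      filter_upwards [Filter.eventually_ge_atTop N] with j hj y hy
      have h1 := hN j hj (n+1) y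
      have hy' : v x / 2 < v y := hy
      rw [mul_assoc] at h1
      have h3 : ‖iteratedFDeriv ℝ (n+1) (F j) y - p y (n+1)‖ * (v x / 2 * c (n+1)) ≤
          ε / 2 * (v x / 2 * c (n+1)) := by
        refine le_trans ?_ h1
        gcongr
      have h2 := le_of_mul_le_mul_right h3 (by positivity)
      rw [dist_comm]
      have h5 : ‖(iteratedFDeriv ℝ (n+1) (F j) y - p y (n+1)).curryLeft‖ < ε := by
        rw [ContinuousMultilinearMap.curryLeft_norm]
        linarith
      exact lt_of_eq_of_lt (dist_eq_norm
        (E := EuclideanSpace ℝ (Fin d) →L[ℝ] (EuclideanSpace ℝ (Fin d) [×n]→L[ℝ] ℂ)) _ _) h5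
  have hT : HasFTaylorSeriesUpTo (⊤ : ℕ∞) (fun x => (p x 0).curry0) p := by
    have hd : ∀ (m : ℕ) x, HasFDerivAt (fun y => p y m) (p x m.succ).curryLeft x := by
      intro m x
      refine hasFDerivAt_of_tendstoLocallyUniformlyOn isOpen_univ (hunif m) ?_
        (fun y _ => hp y m) (mem_univ x)
      intro j y _
      exact ((contDiff_iff_ftaylorSeries.1 (hFsm j)).fderiv m
        (by exact_mod_cast ENat.natCast_lt_top m) y)
    exact ⟨fun x => rfl, fun m _ x => hd m x,
      fun m _ => continuous_iff_continuousAt.2 fun x => (hd m x).continuousAt⟩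
  have heq : ∀ (n : ℕ) x, iteratedFDeriv ℝ n (fun x => (p x 0).curry0) x = p x n := by
    intro n x
    exact (hT.eq_iteratedFDeriv (by exact_mod_cast le_top) x).symm
  refine ⟨fun x => (p x 0).curry0, hT.contDiff, ?_, ?_⟩
  · obtain ⟨N, hN⟩ := hlim 1 one_pos
    obtain ⟨M, hM⟩ := hFb N
    refine ⟨M + 1, fun n x => ?_⟩
    rw [heq]
    have h1 := hN N le_rfl n x
    have h2 := hM n x
    have h3 : ‖p x n‖ ≤ ‖iteratedFDeriv ℝ n (F N) x‖ +
        ‖iteratedFDeriv ℝ n (F N) x - p x n‖ := norm_le_norm_add_norm_sub _ _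
    have hq : 0 < v x * c n := mul_pos (hv x) (hcpos n)
    have h4 := mul_le_mul_of_nonneg_right h3 hq.le
    change ‖iteratedFDeriv ℝ n (F N) x‖ * v x * c n ≤ M at h2
    change ‖p x n‖ * v x * c n ≤ M + 1
    linarith
  · intro ε hε
    obtain ⟨N, hN⟩ := hlim ε hε
    refine ⟨N, fun j hj n x => ?_⟩
    rw [heq]
    exact hN j hj n x
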